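/- arXiv:1912.13205 — 7 statements merged into one kernel-verified Lean document; each statement's English description precedes it below -/
import Mathlib

section
/- Let q > 0 and p ≥ 2. Let f : ℝ → ℝ be nonnegative, convex, even (f(−x) = f(x) for all x) and of polynomial growth of degree p. Define ψ(x) := ∫₀^∞ e^{−(q+1)t} ( ∫_ℝ f(x+y) N(0,t)(dy) ) dt. Then ψ(x) < ∞ for every x ∈ ℝ, ψ is even, ψ is convex, and ψ attains its global minimum at zero, i.e. ψ(x) ≥ ψ(0) for all x ∈ ℝ. -/
open MeasureTheory ProbabilityTheory

/-- The resolvent-type integral `ψ(x) = ∫₀^∞ e^{-(q+1)t} (∫ f(x+y) N(0,t)(dy)) dt`,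
as an extended-nonnegative-real-valued integral (so that finiteness can be asserted). -/
noncomputable def gaussResolvent (q : ℝ) (f : ℝ → ℝ) (x : ℝ) : ENNReal :=
  ∫⁻ t in Set.Ioi (0 : ℝ),
    ENNReal.ofReal (Real.exp (-(q + 1) * t)) *
      ∫⁻ y, ENNReal.ofReal (f (x + y)) ∂(gaussianReal 0 t.toNNReal)

lemma rpow_abs_le_mul_exp {p : ℝ} (hp : 0 < p) (z : ℝ) :
    |z| ^ p ≤ p ^ p * Real.exp |z| := by
  have h : |z| ≤ p * Real.exp (|z| / p) := by
    have h1 := Real.add_one_le_exp (|z| / p)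
    have h2 : |z| = p * (|z| / p) := by field_simp
    calc |z| = p * (|z| / p) := h2
      _ ≤ p * Real.exp (|z| / p) := by gcongr; linarith
  calc |z| ^ p ≤ (p * Real.exp (|z| / p)) ^ p := by gcongr
    _ = p ^ p * Real.exp |z| := by
      rw [Real.mul_rpow hp.le (Real.exp_pos _).le, ← Real.exp_mul]
      congr 2
      field_simp

lemma one_add_rpow_abs_le {p : ℝ} (hp : 0 < p) (z : ℝ) :
    1 + |z| ^ p ≤ (1 + p ^ p) * (Real.exp z + Real.exp (-z)) := by
  have h1 := rpow_abs_le_mul_exp hp z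
  have h2 : 1 ≤ Real.exp |z| := Real.one_le_exp (abs_nonneg z)
  have h3 := Real.exp_abs_le z
  have h4 : 0 ≤ p ^ p := by positivity
  nlinarith

lemma lintegral_exp_add_exp_neg_gaussianReal (t : NNReal) (x : ℝ) :
    ∫⁻ y, ENNReal.ofReal (Real.exp (x + y) + Real.exp (-(x + y))) ∂(gaussianReal 0 t) =
      ENNReal.ofReal ((Real.exp x + Real.exp (-x)) * Real.exp (t / 2)) := by
  have hm : ∀ a : ℝ, ∫ y, Real.exp (a * y) ∂(gaussianReal 0 t) = Real.exp (t * a ^ 2 / 2) := by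
    intro a
    have h := congrFun (mgf_id_gaussianReal (μ := 0) (v := t)) a
    simpa [mgf] using h
  have hi (a c : ℝ) : Integrable (fun y => c * Real.exp (a * y)) (gaussianReal 0 t) :=
    (integrable_exp_mul_gaussianReal a).const_mul c
  have he : ∀ y, Real.exp (x + y) + Real.exp (-(x + y)) =
      Real.exp x * Real.exp (1 * y) + Real.exp (-x) * Real.exp (-1 * y) := by
    intro y
    rw [← Real.exp_add, ← Real.exp_add]
    ring_nf
  simp_rw [he]
  have hadd : Integrable (fun y => Real.exp x * Real.exp (1 * y) +
      Real.exp (-x) * Real.exp (-1 * y)) (gaussianReal 0 t) := (hi _ _).add (hi _ _)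
  rw [← ofReal_integral_eq_lintegral_ofReal hadd
    (Filter.Eventually.of_forall fun y => by positivity),
    integral_add (hi _ _) (hi _ _), integral_const_mul, integral_const_mul, hm, hm]
  congr 1
  ring_nf

lemma gaussResolvent_lt_top {q p : ℝ} (hq : 0 < q) (hp : 0 < p) {f : ℝ → ℝ} {C : ℝ}
    (hC : 0 < C) (hf_growth : ∀ x, |f x| ≤ C * (1 + |x| ^ p)) (x : ℝ) :
    gaussResolvent q f x < ⊤ := by
  set K := C * (1 + p ^ p)
  have hK : 0 ≤ K := by positivity
  set L := K * (Real.exp x + Real.exp (-x))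
  have hbound : ∀ z, f z ≤ K * (Real.exp z + Real.exp (-z)) := fun z =>
    (le_abs_self _).trans <| (hf_growth z).trans <| by
      rw [mul_assoc]
      exact mul_le_mul_of_nonneg_left (one_add_rpow_abs_le hp z) hC.le
  have hinner : ∀ t : ℝ, 0 < t →
      ENNReal.ofReal (Real.exp (-(q + 1) * t)) *
        ∫⁻ y, ENNReal.ofReal (f (x + y)) ∂(gaussianReal 0 t.toNNReal) ≤
      ENNReal.ofReal (L * Real.exp (-(q + 1 / 2) * t)) := by
    intro t ht
    have h : ∫⁻ y, ENNReal.ofReal (f (x + y)) ∂(gaussianReal 0 t.toNNReal) ≤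
        ENNReal.ofReal (L * Real.exp (t / 2)) := by
      calc _ ≤ ∫⁻ y, ENNReal.ofReal K * ENNReal.ofReal
              (Real.exp (x + y) + Real.exp (-(x + y))) ∂(gaussianReal 0 t.toNNReal) := by
            refine lintegral_mono fun y => ?_
            rw [← ENNReal.ofReal_mul hK]
            exact ENNReal.ofReal_le_ofReal (hbound _)
        _ = _ := by
            rw [lintegral_const_mul _ (by fun_prop), lintegral_exp_add_exp_neg_gaussianReal,
              ← ENNReal.ofReal_mul hK, Real.coe_toNNReal _ ht.le, ← mul_assoc]
    refine (mul_le_mul_right h _).trans_eq ?_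
    rw [← ENNReal.ofReal_mul (Real.exp_pos _).le, mul_left_comm, ← Real.exp_add]
    ring_nf
  refine (setLIntegral_mono' measurableSet_Ioi hinner).trans_lt ?_
  exact ((exp_neg_integrableOn_Ioi 0 (by linarith : 0 < q + 1 / 2)).const_mul L).lintegral_lt_top

lemma gaussResolvent_neg (q : ℝ) {f : ℝ → ℝ} (hf : Measurable f) (hf_even : ∀ x, f (-x) = f x)
    (x : ℝ) : gaussResolvent q f (-x) = gaussResolvent q f x := by
  unfold gaussResolvent
  refine lintegral_congr fun t => ?_
  congr 1
  have hmap : (gaussianReal 0 t.toNNReal).map (fun y => -y) = gaussianReal 0 t.toNNReal := by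
    rw [gaussianReal_map_neg, neg_zero]
  conv_lhs => rw [← hmap]
  rw [lintegral_map (by fun_prop) (by fun_prop)]
  refine lintegral_congr fun y => ?_
  rw [← hf_even (x + y), neg_add]

lemma lintegral_gaussianReal_eq_standard {g : ℝ → ENNReal} (hg : Measurable g) {t : ℝ}
    (ht : 0 ≤ t) :
    ∫⁻ y, g y ∂(gaussianReal 0 t.toNNReal) = ∫⁻ y, g (√t * y) ∂(gaussianReal 0 1) := by
  have hmap : (gaussianReal 0 1).map (fun y => √t * y) = gaussianReal 0 t.toNNReal := by
    rw [gaussianReal_map_const_mul]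
    congr 1
    · simp
    · ext
      simp [ht]
  rw [← hmap, lintegral_map hg (by fun_prop)]

lemma gaussResolvent_eq_lintegral_prod (q : ℝ) {f : ℝ → ℝ} (hf : Measurable f) (x : ℝ) :
    gaussResolvent q f x =
      ∫⁻ z, ENNReal.ofReal (Real.exp (-(q + 1) * z.1)) * ENNReal.ofReal (f (x + √z.1 * z.2))
        ∂((volume.restrict (Set.Ioi (0 : ℝ))).prod (gaussianReal 0 1)) := by
  rw [lintegral_prod _ (by fun_prop)]
  refine setLIntegral_congr_fun measurableSet_Ioi fun t ht => ?_
  dsimp only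
  rw [lintegral_const_mul _ (by fun_prop), lintegral_gaussianReal_eq_standard
    (g := fun y => ENNReal.ofReal (f (x + y))) (by fun_prop) (le_of_lt ht)]

lemma gaussResolvent_convex_combination_le (q : ℝ) {f : ℝ → ℝ} (hf : Measurable f)
    (hf_conv : ConvexOn ℝ Set.univ f) (x y : ℝ) {a b : ℝ}
    (ha : 0 ≤ a) (hb : 0 ≤ b) (hab : a + b = 1) :
    gaussResolvent q f (a * x + b * y) ≤
      ENNReal.ofReal a * gaussResolvent q f x + ENNReal.ofReal b * gaussResolvent q f y := by
  simp_rw [gaussResolvent_eq_lintegral_prod q hf]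
  rw [← lintegral_const_mul _ (by fun_prop), ← lintegral_const_mul _ (by fun_prop),
    ← lintegral_add_left (by fun_prop)]
  refine lintegral_mono fun z => ?_
  have h := hf_conv.2 (Set.mem_univ (x + √z.1 * z.2)) (Set.mem_univ (y + √z.1 * z.2)) ha hb hab
  have hz : a • (x + √z.1 * z.2) + b • (y + √z.1 * z.2) = a * x + b * y + √z.1 * z.2 := by
    simp only [smul_eq_mul]
    linear_combination (√z.1 * z.2) * hab
  rw [hz] at h
  calc _ ≤ ENNReal.ofReal (Real.exp (-(q + 1) * z.1)) *
        (ENNReal.ofReal (a * f (x + √z.1 * z.2)) + ENNReal.ofReal (b * f (y + √z.1 * z.2))) := by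
        gcongr
        exact (ENNReal.ofReal_le_ofReal h).trans ENNReal.ofReal_add_le
    _ = _ := by
        rw [ENNReal.ofReal_mul ha, ENNReal.ofReal_mul hb]
        ring

theorem stmt0 (q p : ℝ) (hq : 0 < q) (hp : 2 ≤ p) (f : ℝ → ℝ)
    (hf_nonneg : ∀ x, 0 ≤ f x) (hf_conv : ConvexOn ℝ Set.univ f)
    (hf_even : ∀ x, f (-x) = f x)
    (C : ℝ) (hC : 0 < C) (hf_growth : ∀ x, |f x| ≤ C * (1 + |x| ^ p)) :
    (∀ x : ℝ, gaussResolvent q f x < ⊤) ∧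
    (∀ x : ℝ, gaussResolvent q f (-x) = gaussResolvent q f x) ∧
    ConvexOn ℝ Set.univ (fun x => (gaussResolvent q f x).toReal) ∧
    (∀ x : ℝ, (gaussResolvent q f 0).toReal ≤ (gaussResolvent q f x).toReal) := by
  have hf : Measurable f :=
    (continuousOn_univ.mp (hf_conv.continuousOn isOpen_univ)).measurable
  have hfin : ∀ x, gaussResolvent q f x < ⊤ :=
    gaussResolvent_lt_top hq (by linarith) hC hf_growth
  have heven := gaussResolvent_neg q hf hf_even
  have hconv : ConvexOn ℝ Set.univ (fun x => (gaussResolvent q f x).toReal) := by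
    refine ⟨convex_univ, fun x _ y _ a b ha hb hab => ?_⟩
    have hx := ENNReal.mul_ne_top (ENNReal.ofReal_ne_top (r := a)) (hfin x).ne
    have hy := ENNReal.mul_ne_top (ENNReal.ofReal_ne_top (r := b)) (hfin y).ne
    have h := ENNReal.toReal_mono (ENNReal.add_ne_top.2 ⟨hx, hy⟩)
      (gaussResolvent_convex_combination_le q hf hf_conv x y ha hb hab)
    simpa [ENNReal.toReal_add hx hy, ha, hb] using h
  refine ⟨hfin, heven, hconv, fun x => ?_⟩
  have h := hconv.2 (Set.mem_univ x) (Set.mem_univ (-x))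
    (by norm_num : (0 : ℝ) ≤ 1 / 2) (by norm_num : (0 : ℝ) ≤ 1 / 2) (by norm_num)
  simp only [heven, smul_eq_mul, mul_neg, add_neg_cancel] at h
  linarith
end

section
/- Let q > 0 and p ≥ 2. Let f : ℝ → ℝ be continuous, nonnegative and of polynomial growth of degree p. Then the function ψ(x) := ∫₀^∞ e^{−(q+1)t} ( ∫_ℝ f(x+y) N(0,t)(dy) ) dt is twice continuously differentiable on ℝ and satisfies the ordinary differential equation (1/2)ψ''(x) − (q+1)ψ(x) + f(x) = 0 for all x ∈ ℝ. -/
open MeasureTheory ProbabilityTheory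

/-- `ψ(x) = ∫₀^∞ e^{-(q+1)t} (∫ f(x+y) N(0,t)(dy)) dt`. -/
noncomputable def gaussResolventReal (q : ℝ) (f : ℝ → ℝ) (x : ℝ) : ℝ :=
  ∫ t in Set.Ioi (0 : ℝ),
    Real.exp (-(q + 1) * t) * ∫ y, f (x + y) ∂(gaussianReal 0 t.toNNReal)

open Filter Topology

/-- An unnormalised error function. -/
noncomputable def gaussPrimitive (u : ℝ) : ℝ :=
  ∫ v in (0 : ℝ)..u, Real.exp (-(1 / 2) * v ^ 2)

lemma hasDerivAt_gaussPrimitive (u : ℝ) :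
    HasDerivAt gaussPrimitive (Real.exp (-(1 / 2) * u ^ 2)) u := by
  have hc : Continuous fun v : ℝ => Real.exp (-(1 / 2) * v ^ 2) := by fun_prop
  exact intervalIntegral.integral_hasDerivAt_right (hc.intervalIntegrable _ _)
    hc.aestronglyMeasurable.stronglyMeasurableAtFilter hc.continuousAt

lemma gaussPrimitive_neg (u : ℝ) : gaussPrimitive (-u) = -gaussPrimitive u := by
  have h := intervalIntegral.integral_comp_neg (a := 0) (b := u)
    (fun v : ℝ => Real.exp (-(1 / 2) * v ^ 2))
  simp only [neg_sq, neg_zero] at h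
  rw [gaussPrimitive, gaussPrimitive, h, intervalIntegral.integral_symm]

lemma tendsto_gaussPrimitive_atTop :
    Tendsto gaussPrimitive atTop (𝓝 (√(2 * Real.pi) / 2)) := by
  have h := intervalIntegral_tendsto_integral_Ioi (μ := volume) (l := atTop) (b := id) 0
    (integrable_exp_neg_mul_sq (b := 1 / 2) (by norm_num)).integrableOn tendsto_id
  rw [integral_gaussian_Ioi] at h
  rwa [show Real.pi / (1 / 2) = 2 * Real.pi by ring] at h

lemma tendsto_gaussPrimitive_atBot :
    Tendsto gaussPrimitive atBot (𝓝 (-(√(2 * Real.pi) / 2))) := by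
  refine (tendsto_gaussPrimitive_atTop.comp tendsto_neg_atBot_atTop).neg.congr fun u => ?_
  simp [gaussPrimitive_neg]

/-- A primitive in `t` of `e^{-a²t/2}` times the density of `N(0,t)` at `y`. -/
noncomputable def heatPrimitive (a y t : ℝ) : ℝ :=
  (√(2 * Real.pi) * a)⁻¹ * (Real.exp (-a * y) * gaussPrimitive (a * √t - y / √t) -
    Real.exp (a * y) * gaussPrimitive (-a * √t - y / √t))

lemma hasDerivAt_heatPrimitive {a : ℝ} (ha : 0 < a) (y : ℝ) {t : ℝ} (ht : 0 < t) :
    HasDerivAt (heatPrimitive a y)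
      (Real.exp (-(a ^ 2 / 2) * t) * gaussianPDFReal 0 t.toNNReal y) t := by
  have hs : 0 < √t := Real.sqrt_pos.2 ht
  have hss : √t ^ 2 = t := Real.sq_sqrt ht.le
  have hsqrt := Real.hasDerivAt_sqrt ht.ne'
  have hu (b : ℝ) : HasDerivAt (fun t => b * √t - y / √t)
      (b * (1 / (2 * √t)) - (0 * √t - y * (1 / (2 * √t))) / √t ^ 2) t :=
    (hsqrt.const_mul b).sub ((hasDerivAt_const t y).div hsqrt hs.ne')
  have h := ((((hasDerivAt_gaussPrimitive _).comp t (hu a)).const_mul (Real.exp (-a * y))).sub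
    (((hasDerivAt_gaussPrimitive _).comp t (hu (-a))).const_mul (Real.exp (a * y)))).const_mul
    (√(2 * Real.pi) * a)⁻¹
  refine h.congr_deriv ?_
  have e1 : Real.exp (-a * y) * Real.exp (-(1 / 2) * (a * √t - y / √t) ^ 2) =
      Real.exp (-(a ^ 2 / 2) * t) * Real.exp (-(y - 0) ^ 2 / (2 * t)) := by
    rw [← Real.exp_add, ← Real.exp_add, ← hss]
    congr 1
    simp only [Real.sqrt_sq hs.le]
    field_simp
    ring
  have e2 : Real.exp (a * y) * Real.exp (-(1 / 2) * (-a * √t - y / √t) ^ 2) =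
      Real.exp (-(a ^ 2 / 2) * t) * Real.exp (-(y - 0) ^ 2 / (2 * t)) := by
    rw [← Real.exp_add, ← Real.exp_add, ← hss]
    congr 1
    simp only [Real.sqrt_sq hs.le]
    field_simp
    ring
  rw [← mul_assoc (Real.exp (-a * y)), ← mul_assoc (Real.exp (a * y)), e1, e2, gaussianPDFReal,
    Real.coe_toNNReal t ht.le, Real.sqrt_mul (by positivity) t]
  have hpi : 0 < √(2 * Real.pi) := by positivity
  field_simp
  ring

lemma tendsto_heatPrimitive_atTop {a : ℝ} (ha : 0 < a) (y : ℝ) :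
    Tendsto (heatPrimitive a y) atTop (𝓝 ((√(2 * Real.pi) * a)⁻¹ *
      (Real.exp (-a * y) * (√(2 * Real.pi) / 2) -
        Real.exp (a * y) * (-(√(2 * Real.pi) / 2))))) := by
  have h0 : Tendsto (fun t : ℝ => -(y / √t)) atTop (𝓝 (-0)) :=
    (tendsto_const_nhds.div_atTop Real.tendsto_sqrt_atTop).neg
  have h1 : Tendsto (fun t : ℝ => a * √t - y / √t) atTop atTop :=
    (Real.tendsto_sqrt_atTop.const_mul_atTop ha).atTop_add h0
  have h2 : Tendsto (fun t : ℝ => -a * √t - y / √t) atTop atBot :=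
    (Real.tendsto_sqrt_atTop.const_mul_atTop_of_neg (neg_lt_zero.2 ha)).atBot_add h0
  exact (((tendsto_gaussPrimitive_atTop.comp h1).const_mul _).sub
    ((tendsto_gaussPrimitive_atBot.comp h2).const_mul _)).const_mul _

lemma tendsto_heatPrimitive_zero (a : ℝ) {y : ℝ} (hy : 0 < y) :
    Tendsto (heatPrimitive a y) (𝓝[>] 0) (𝓝 ((√(2 * Real.pi) * a)⁻¹ *
      (Real.exp (-a * y) * (-(√(2 * Real.pi) / 2)) -
        Real.exp (a * y) * (-(√(2 * Real.pi) / 2))))) := by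
  have hs : Tendsto (fun t : ℝ => √t) (𝓝[>] 0) (𝓝[>] 0) := by
    refine tendsto_nhdsWithin_iff.2 ⟨?_, ?_⟩
    · simpa using (Real.continuous_sqrt.tendsto 0).mono_left nhdsWithin_le_nhds
    · filter_upwards [self_mem_nhdsWithin] with t ht using Real.sqrt_pos.2 ht
  have h0 : Tendsto (fun t : ℝ => -(y / √t)) (𝓝[>] 0) atBot :=
    tendsto_neg_atTop_atBot.comp
      ((tendsto_inv_nhdsGT_zero.comp hs).const_mul_atTop hy)
  have h1 (b : ℝ) : Tendsto (fun t : ℝ => b * √t - y / √t) (𝓝[>] 0) atBot :=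
    Tendsto.add_atBot ((hs.mono_right nhdsWithin_le_nhds).const_mul b) h0
  exact (((tendsto_gaussPrimitive_atBot.comp (h1 a)).const_mul _).sub
    ((tendsto_gaussPrimitive_atBot.comp (h1 (-a))).const_mul _)).const_mul _

lemma integral_exp_mul_gaussianPDFReal_of_pos {a y : ℝ} (ha : 0 < a) (hy : 0 < y) :
    IntegrableOn (fun t => Real.exp (-(a ^ 2 / 2) * t) * gaussianPDFReal 0 t.toNNReal y)
        (Set.Ioi 0) ∧
      ∫ t in Set.Ioi (0 : ℝ), Real.exp (-(a ^ 2 / 2) * t) * gaussianPDFReal 0 t.toNNReal y =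
        a⁻¹ * Real.exp (-a * y) := by
  have hcont := continuousWithinAt_update_same.2
    ((Set.Ici_sdiff_left (a := (0 : ℝ))).symm ▸ tendsto_heatPrimitive_zero a hy)
  have hderiv (l : ℝ) : ∀ t ∈ Set.Ioi (0 : ℝ), HasDerivAt (Function.update (heatPrimitive a y) 0 l)
      (Real.exp (-(a ^ 2 / 2) * t) * gaussianPDFReal 0 t.toNNReal y) t := fun t ht =>
    (hasDerivAt_heatPrimitive ha y ht).congr_of_eventuallyEq <| by
      filter_upwards [isOpen_ne.mem_nhds (ne_of_gt ht)] with s hs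
      exact Function.update_of_ne hs _ _
  have hnn : ∀ t ∈ Set.Ioi (0 : ℝ),
      0 ≤ Real.exp (-(a ^ 2 / 2) * t) * gaussianPDFReal 0 t.toNNReal y := fun t _ =>
    mul_nonneg (Real.exp_pos _).le (gaussianPDFReal_nonneg _ _ _)
  have hlim (l : ℝ) : Tendsto (Function.update (heatPrimitive a y) 0 l) atTop _ :=
    (tendsto_heatPrimitive_atTop ha y).congr' <| by
      filter_upwards [eventually_ne_atTop 0] with s hs
      exact (Function.update_of_ne hs _ _).symm
  refine ⟨integrableOn_Ioi_deriv_of_nonneg hcont (hderiv _) hnn (hlim _), ?_⟩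
  rw [integral_Ioi_of_hasDerivAt_of_nonneg hcont (hderiv _) hnn (hlim _), Function.update_self]
  have hpi : 0 < √(2 * Real.pi) := by positivity
  field_simp
  ring

lemma integral_exp_mul_gaussianPDFReal {a y : ℝ} (ha : 0 < a) (hy : y ≠ 0) :
    IntegrableOn (fun t => Real.exp (-(a ^ 2 / 2) * t) * gaussianPDFReal 0 t.toNNReal y)
        (Set.Ioi 0) ∧
      ∫ t in Set.Ioi (0 : ℝ), Real.exp (-(a ^ 2 / 2) * t) * gaussianPDFReal 0 t.toNNReal y =
        a⁻¹ * Real.exp (-a * |y|) := by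
  have h := integral_exp_mul_gaussianPDFReal_of_pos ha (abs_pos.2 hy)
  simpa only [gaussianPDFReal, sub_zero, sq_abs] using h

section Growth

variable {f : ℝ → ℝ} {p C : ℝ}

lemma integrableOn_exp_neg_mul_Ioi (hf : Continuous f)
    (hg : ∀ x, |f x| ≤ C * (1 + |x| ^ p)) {a : ℝ} (ha : 0 < a) (x : ℝ) :
    IntegrableOn (fun z => Real.exp (-a * z) * f z) (Set.Ioi x) := by
  refine integrable_of_isBigO_exp_neg (half_pos ha) (by fun_prop) ?_
  have h1 : f =O[atTop] fun z : ℝ => 1 + z ^ p := by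
    refine Asymptotics.IsBigO.of_bound C ?_
    filter_upwards [eventually_ge_atTop 0] with z hz
    have := hg z
    rw [abs_of_nonneg hz] at this
    rwa [Real.norm_eq_abs, Real.norm_of_nonneg (by positivity)]
  have h0 : (fun _ : ℝ => (1 : ℝ)) =O[atTop] fun z => Real.exp (a / 2 * z) := by
    simpa using (isLittleO_rpow_exp_pos_mul_atTop 0 (half_pos ha)).isBigO
  have h2 : f =O[atTop] fun z => Real.exp (a / 2 * z) :=
    h1.trans (h0.add (isLittleO_rpow_exp_pos_mul_atTop p (half_pos ha)).isBigO)
  refine ((Asymptotics.isBigO_refl (fun z => Real.exp (-a * z)) atTop).mul h2).congr_right ?_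
  intro z
  rw [← Real.exp_add]
  ring_nf

lemma integrableOn_exp_mul_mul_Iic (hf : Continuous f)
    (hg : ∀ x, |f x| ≤ C * (1 + |x| ^ p)) {a : ℝ} (ha : 0 < a) (x : ℝ) :
    IntegrableOn (fun z => Real.exp (a * z) * f z) (Set.Iic x) := by
  have h := integrableOn_exp_neg_mul_Ioi (f := fun z => f (-z)) (hf.comp continuous_neg)
    (fun z => by simpa using hg (-z)) ha (-x)
  simpa using ((integrableOn_Ici_iff_integrableOn_Ioi enorm_ne_top).2 h).comp_neg_Iic

lemma integrableOn_laplaceKernel_Iic (hf : Continuous f)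
    (hg : ∀ x, |f x| ≤ C * (1 + |x| ^ p)) {a : ℝ} (ha : 0 < a) (x : ℝ) :
    IntegrableOn (fun z => a⁻¹ * Real.exp (-a * |z - x|) * f z) (Set.Iic x) ∧
    ∫ z in Set.Iic x, a⁻¹ * Real.exp (-a * |z - x|) * f z =
      a⁻¹ * Real.exp (-a * x) * ∫ z in Set.Iic x, Real.exp (a * z) * f z := by
  have he : Set.EqOn (fun z => a⁻¹ * Real.exp (-a * |z - x|) * f z)
      (fun z => a⁻¹ * Real.exp (-a * x) * (Real.exp (a * z) * f z)) (Set.Iic x) := fun z hz => by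
    have : -a * |z - x| = -a * x + a * z := by
      rw [abs_of_nonpos (sub_nonpos.2 hz)]; ring
    simp only [this, Real.exp_add]
    ring
  rw [integrableOn_congr_fun he measurableSet_Iic, setIntegral_congr_fun measurableSet_Iic he,
    integral_const_mul]
  exact ⟨(integrableOn_exp_mul_mul_Iic hf hg ha x).const_mul _, rfl⟩

lemma integrableOn_laplaceKernel_Ioi (hf : Continuous f)
    (hg : ∀ x, |f x| ≤ C * (1 + |x| ^ p)) {a : ℝ} (ha : 0 < a) (x : ℝ) :
    IntegrableOn (fun z => a⁻¹ * Real.exp (-a * |z - x|) * f z) (Set.Ioi x) ∧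
    ∫ z in Set.Ioi x, a⁻¹ * Real.exp (-a * |z - x|) * f z =
      a⁻¹ * Real.exp (a * x) * ∫ z in Set.Ioi x, Real.exp (-a * z) * f z := by
  have he : Set.EqOn (fun z => a⁻¹ * Real.exp (-a * |z - x|) * f z)
      (fun z => a⁻¹ * Real.exp (a * x) * (Real.exp (-a * z) * f z)) (Set.Ioi x) := fun z hz => by
    have : -a * |z - x| = a * x + -a * z := by
      rw [abs_of_pos (sub_pos.2 hz)]; ring
    simp only [this, Real.exp_add]
    ring
  rw [integrableOn_congr_fun he measurableSet_Ioi, setIntegral_congr_fun measurableSet_Ioi he,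
    integral_const_mul]
  exact ⟨(integrableOn_exp_neg_mul_Ioi hf hg ha x).const_mul _, rfl⟩

lemma integrable_laplaceKernel (hf : Continuous f)
    (hg : ∀ x, |f x| ≤ C * (1 + |x| ^ p)) {a : ℝ} (ha : 0 < a) (x : ℝ) :
    Integrable (fun y => a⁻¹ * Real.exp (-a * |y|) * f (x + y)) := by
  have h : Integrable (fun z => a⁻¹ * Real.exp (-a * |z - x|) * f z) := by
    rw [← integrableOn_univ, ← Set.Iic_union_Ioi (a := x)]
    exact (integrableOn_laplaceKernel_Iic hf hg ha x).1.union
      (integrableOn_laplaceKernel_Ioi hf hg ha x).1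
  simpa using h.comp_add_left x

lemma integral_laplaceKernel (hf : Continuous f)
    (hg : ∀ x, |f x| ≤ C * (1 + |x| ^ p)) {a : ℝ} (ha : 0 < a) (x : ℝ) :
    ∫ y, a⁻¹ * Real.exp (-a * |y|) * f (x + y) =
      a⁻¹ * (Real.exp (-a * x) * (∫ z in Set.Iic x, Real.exp (a * z) * f z) +
        Real.exp (a * x) * ∫ z in Set.Ioi x, Real.exp (-a * z) * f z) := by
  have h := integral_add_left_eq_self (μ := volume)
    (fun z => a⁻¹ * Real.exp (-a * |z - x|) * f z) x
  simp only [add_sub_cancel_left] at h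
  rw [h, ← intervalIntegral.integral_Iic_add_Ioi (integrableOn_laplaceKernel_Iic hf hg ha x).1
    (integrableOn_laplaceKernel_Ioi hf hg ha x).1, (integrableOn_laplaceKernel_Iic hf hg ha x).2,
    (integrableOn_laplaceKernel_Ioi hf hg ha x).2]
  ring

lemma gaussResolventReal_eq_integral_laplaceKernel (hf : Continuous f)
    (hg : ∀ x, |f x| ≤ C * (1 + |x| ^ p)) {a q : ℝ} (ha : 0 < a) (haq : a ^ 2 / 2 = q + 1)
    (x : ℝ) :
    gaussResolventReal q f x = ∫ y, a⁻¹ * Real.exp (-a * |y|) * f (x + y) := by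
  have hne : ∀ᵐ y : ℝ, y ≠ 0 := by simp [ae_iff]
  have hmeas : Measurable (Function.uncurry fun t y : ℝ =>
      Real.exp (-(a ^ 2 / 2) * t) * gaussianPDFReal 0 t.toNNReal y * f (x + y)) := by
    have := hf.measurable
    unfold gaussianPDFReal Function.uncurry
    fun_prop
  have hint : Integrable (Function.uncurry fun t y : ℝ =>
      Real.exp (-(a ^ 2 / 2) * t) * gaussianPDFReal 0 t.toNNReal y * f (x + y))
      ((volume.restrict (Set.Ioi 0)).prod volume) := by
    rw [integrable_prod_iff' hmeas.aestronglyMeasurable]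
    refine ⟨?_, ?_⟩
    · filter_upwards [hne] with y hy
      exact (integral_exp_mul_gaussianPDFReal ha hy).1.mul_const (f (x + y))
    · refine (integrable_laplaceKernel hf hg ha x).norm.congr ?_
      filter_upwards [hne] with y hy
      simp only [Function.uncurry, norm_mul, Real.norm_of_nonneg (Real.exp_pos _).le,
        Real.norm_of_nonneg (gaussianPDFReal_nonneg _ _ _), integral_mul_const,
        (integral_exp_mul_gaussianPDFReal ha hy).2, Real.norm_of_nonneg (inv_pos.2 ha).le]
  calc
    gaussResolventReal q f x = ∫ t in Set.Ioi (0 : ℝ), ∫ y,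
        Real.exp (-(a ^ 2 / 2) * t) * gaussianPDFReal 0 t.toNNReal y * f (x + y) := by
      refine setIntegral_congr_fun measurableSet_Ioi fun t ht => ?_
      simp only [integral_gaussianReal_eq_integral_smul (Real.toNNReal_pos.2 ht).ne', smul_eq_mul,
        haq, ← integral_const_mul, mul_assoc]
    _ = ∫ y, ∫ t in Set.Ioi (0 : ℝ),
        Real.exp (-(a ^ 2 / 2) * t) * gaussianPDFReal 0 t.toNNReal y * f (x + y) :=
      integral_integral_swap hint
    _ = _ := by
      refine integral_congr_ae ?_
      filter_upwards [hne] with y hy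
      rw [integral_mul_const, (integral_exp_mul_gaussianPDFReal ha hy).2]

end Growth

lemma hasDerivAt_integral_Iic {g : ℝ → ℝ} (hg : Continuous g)
    (hi : ∀ x, IntegrableOn g (Set.Iic x)) (x : ℝ) :
    HasDerivAt (fun u => ∫ z in Set.Iic u, g z) (g x) x := by
  have h := (intervalIntegral.integral_hasDerivAt_right (hg.intervalIntegrable 0 x)
    hg.aestronglyMeasurable.stronglyMeasurableAtFilter hg.continuousAt).add_const
    (∫ z in Set.Iic 0, g z)
  refine h.congr_of_eventuallyEq (Eventually.of_forall fun u => ?_)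
  simp only [← intervalIntegral.integral_Iic_sub_Iic (hi 0) (hi u), sub_add_cancel]

lemma hasDerivAt_integral_Ioi {g : ℝ → ℝ} (hg : Continuous g)
    (hi : ∀ x, IntegrableOn g (Set.Ioi x)) (x : ℝ) :
    HasDerivAt (fun u => ∫ z in Set.Ioi u, g z) (-g x) x := by
  have h := (intervalIntegral.integral_hasDerivAt_right (hg.intervalIntegrable 0 x)
    hg.aestronglyMeasurable.stronglyMeasurableAtFilter hg.continuousAt).const_sub
    (∫ z in Set.Ioi 0, g z)
  refine h.congr_of_eventuallyEq (Eventually.of_forall fun u => ?_)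
  simp only [← intervalIntegral.integral_interval_add_Ioi (hi 0) (hi u), add_sub_cancel_left]

theorem stmt1 (q p : ℝ) (hq : 0 < q) (hp : 2 ≤ p) (f : ℝ → ℝ)
    (hf_cont : Continuous f) (hf_nonneg : ∀ x, 0 ≤ f x)
    (C : ℝ) (hC : 0 < C) (hf_growth : ∀ x, |f x| ≤ C * (1 + |x| ^ p)) :
    ContDiff ℝ 2 (gaussResolventReal q f) ∧
    ∀ x : ℝ,
      (1 / 2) * deriv (deriv (gaussResolventReal q f)) x -
        (q + 1) * gaussResolventReal q f x + f x = 0 := by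
  obtain ⟨a, ha, haq⟩ : ∃ a : ℝ, 0 < a ∧ a ^ 2 / 2 = q + 1 :=
    ⟨√(2 * (q + 1)), by positivity, by rw [Real.sq_sqrt (by positivity)]; ring⟩
  set A : ℝ → ℝ := fun x => ∫ z in Set.Iic x, Real.exp (a * z) * f z with hA
  set B : ℝ → ℝ := fun x => ∫ z in Set.Ioi x, Real.exp (-a * z) * f z with hB
  have hψ : gaussResolventReal q f =
      fun x => a⁻¹ * (Real.exp (-a * x) * A x + Real.exp (a * x) * B x) := by
    funext x
    rw [gaussResolventReal_eq_integral_laplaceKernel hf_cont hf_growth ha haq,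
      integral_laplaceKernel hf_cont hf_growth ha]
  have hdA : ∀ x, HasDerivAt A (Real.exp (a * x) * f x) x :=
    hasDerivAt_integral_Iic (by fun_prop) (integrableOn_exp_mul_mul_Iic hf_cont hf_growth ha)
  have hdB : ∀ x, HasDerivAt B (-(Real.exp (-a * x) * f x)) x :=
    hasDerivAt_integral_Ioi (by fun_prop) (integrableOn_exp_neg_mul_Ioi hf_cont hf_growth ha)
  have hexp (b x : ℝ) : HasDerivAt (fun x => Real.exp (b * x)) (Real.exp (b * x) * b) x := by
    simpa using ((hasDerivAt_id x).const_mul b).exp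
  have hmul (x : ℝ) : Real.exp (-a * x) * Real.exp (a * x) = 1 := by
    rw [← Real.exp_add]; simp
  have hd1 (x : ℝ) : HasDerivAt (gaussResolventReal q f)
      (-(Real.exp (-a * x) * A x) + Real.exp (a * x) * B x) x := by
    rw [hψ]
    refine ((((hexp (-a) x).mul (hdA x)).add ((hexp a x).mul (hdB x))).const_mul a⁻¹).congr_deriv ?_
    field_simp
    ring
  have hd2 (x : ℝ) : HasDerivAt (fun x => -(Real.exp (-a * x) * A x) + Real.exp (a * x) * B x)
      (a ^ 2 * gaussResolventReal q f x - 2 * f x) x := by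
    refine (((hexp (-a) x).mul (hdA x)).neg.add ((hexp a x).mul (hdB x))).congr_deriv ?_
    rw [hψ]
    field_simp
    simp only [neg_mul] at hmul ⊢
    linear_combination (-2 * f x) * hmul x
  have hderiv : deriv (gaussResolventReal q f) =
      fun x => -(Real.exp (-a * x) * A x) + Real.exp (a * x) * B x :=
    funext fun x => (hd1 x).deriv
  have hderiv2 : deriv (deriv (gaussResolventReal q f)) =
      fun x => a ^ 2 * gaussResolventReal q f x - 2 * f x := by
    rw [hderiv]
    exact funext fun x => (hd2 x).deriv
  have hdiff : Differentiable ℝ (gaussResolventReal q f) := fun x => (hd1 x).differentiableAt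
  refine ⟨?_, fun x => ?_⟩
  · rw [show (2 : WithTop ℕ∞) = 1 + 1 from one_add_one_eq_two.symm, contDiff_succ_iff_deriv]
    refine ⟨hdiff, by simp, contDiff_one_iff_deriv.2 ⟨?_, ?_⟩⟩
    · rw [hderiv]
      exact fun x => (hd2 x).differentiableAt
    · rw [hderiv2]
      exact (continuous_const.mul hdiff.continuous).sub (continuous_const.mul hf_cont)
  · rw [hderiv2, ← haq]
    ring
end

section
/- Let q > 0, let ψ : ℝ → ℝ be twice differentiable and let f : ℝ → ℝ be such that (1/2)ψ''(x) − (q+1)ψ(x) + f(x) = 0 for all x ∈ ℝ and ψ(z) ≥ ψ(0) for all z ∈ ℝ. Set c := ψ(0)/q and φ := ψ + c. Then: (i) for every x ∈ ℝ and every Borel measure ν on ℝ with ν(ℝ) ≤ 1 such that y ↦ φ(x+y) is ν-integrable, one has (1/2)φ''(x) + ∫_ℝ (φ(x+y) − φ(x)) ν(dy) − qφ(x) + f(x) ≥ 0; and (ii) for every x ∈ ℝ, choosing ν = δ_{−x}, this expression equals 0, i.e. (1/2)φ''(x) + (φ(0) − φ(x)) − qφ(x) + f(x) = 0. -/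
open MeasureTheory

theorem stmt2 (q : ℝ) (hq : 0 < q) (ψ f : ℝ → ℝ)
    (hψ : Differentiable ℝ ψ) (hψ' : Differentiable ℝ (deriv ψ))
    (hode : ∀ x : ℝ, (1 / 2) * deriv (deriv ψ) x - (q + 1) * ψ x + f x = 0)
    (hmin : ∀ z : ℝ, ψ 0 ≤ ψ z) :
    let c : ℝ := ψ 0 / q
    let φ : ℝ → ℝ := fun x => ψ x + c
    -- (i): subsolution property of the HJB operator for any jump measure of total mass ≤ 1
    (∀ x : ℝ, ∀ ν : Measure ℝ, ν Set.univ ≤ 1 →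
      Integrable (fun y => φ (x + y)) ν →
      0 ≤ (1 / 2) * deriv (deriv φ) x + (∫ y, (φ (x + y) - φ x) ∂ν)
            - q * φ x + f x) ∧
    -- (ii): equality for the choice ν = δ_{-x}
    (∀ x : ℝ, (1 / 2) * deriv (deriv φ) x + (φ 0 - φ x) - q * φ x + f x = 0) := by
  intro c φ
  have hqc : q * c = ψ 0 := mul_div_cancel₀ (ψ 0) hq.ne'
  have hderiv : deriv (deriv φ) = deriv (deriv ψ) := by
    congr 1
    funext x
    exact deriv_add_const c
  have hφ : ∀ z, φ z = ψ z + c := fun _ => rfl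
  refine ⟨fun x ν hν hint => ?_, fun x => ?_⟩
  · have : IsFiniteMeasure ν := ⟨hν.trans_lt ENNReal.one_lt_top⟩
    have hmass : ν.real Set.univ ≤ 1 := ENNReal.toReal_le_of_le_ofReal zero_le_one (by simpa using hν)
    have hjump : ν.real Set.univ * (ψ 0 - ψ x) ≤ ∫ y, (φ (x + y) - φ x) ∂ν := by
      rw [← smul_eq_mul, ← integral_const]
      refine integral_mono (integrable_const _) (hint.sub (integrable_const _)) fun y => ?_
      simp only [hφ]
      linarith [hmin (x + y)]
    have hgap := mul_nonneg (sub_nonneg.2 hmass) (sub_nonneg.2 (hmin x))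
    rw [hderiv, hφ]
    linarith [hode x]
  · rw [hderiv, hφ, hφ]
    linarith [hode x]
end

section
/- Let n ≥ 1, p ≥ 2 and q ∈ [1,p]. Let f : ℝⁿ → ℝ be twice continuously differentiable with |f(x)| ≤ C(‖x‖^q + 1) for all x, for some C > 0, and let ν be a Borel measure on ℝⁿ with ∫ ‖y‖² ∨ ‖y‖^p ν(dy) < ∞. Then the function x ↦ ∫_{ℝⁿ} ( f(x+y) − f(x) − Df(x)y ) ν(dy) is continuous on ℝⁿ. -/
open MeasureTheory

/-- Locally uniform quadratic bound for the first-order Taylor remainder of a `C²` function. -/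
theorem exists_taylor_remainder_le {E : Type*} [NormedAddCommGroup E] [NormedSpace ℝ E]
    [ProperSpace E] {f : E → ℝ} (hf : ContDiff ℝ 2 f) (x₀ : E) :
    ∃ M, 0 ≤ M ∧ ∀ x ∈ Metric.ball x₀ 1, ∀ y, ‖y‖ ≤ 1 →
      ‖f (x + y) - f x - fderiv ℝ f x y‖ ≤ M * ‖y‖ ^ 2 := by
  have hd : ContDiff ℝ 1 (fderiv ℝ f) := hf.fderiv_right (by norm_num)
  obtain ⟨M, hM⟩ := (isCompact_closedBall x₀ 2).exists_bound_of_continuousOn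
    (hd.continuous_fderiv (by norm_num)).continuousOn
  have hM0 : 0 ≤ M := (norm_nonneg _).trans (hM x₀ (by simp))
  refine ⟨M, hM0, fun x hx y hy => ?_⟩
  rw [mem_ball_iff_norm] at hx
  have hmem : ∀ z, ‖z - x‖ ≤ ‖y‖ → z ∈ Metric.closedBall x₀ 2 := fun z hz => by
    rw [mem_closedBall_iff_norm]
    have := norm_sub_le_norm_sub_add_norm_sub z x x₀
    linarith
  have hlip : ∀ z ∈ Metric.closedBall x ‖y‖, ‖fderiv ℝ f z - fderiv ℝ f x‖ ≤ M * ‖y‖ := by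
    intro z hz
    rw [mem_closedBall_iff_norm] at hz
    refine ((convex_closedBall x₀ 2).norm_image_sub_le_of_norm_fderiv_le
      (fun w _ => (hd.differentiable (by norm_num)) w) hM
      (hmem x (by simp)) (hmem z hz)).trans ?_
    gcongr
  have := (convex_closedBall x ‖y‖).norm_image_sub_le_of_norm_fderiv_le'
    (fun w _ => (hf.differentiable (by norm_num)) w) hlip
    (Metric.mem_closedBall_self (norm_nonneg y))
    (show x + y ∈ Metric.closedBall x ‖y‖ by simp)
  rw [add_sub_cancel_left] at this
  linarith

/-- Locally uniform bound, away from zero increments, for the first-order Taylor remainder of a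
`C¹` function of polynomial growth. -/
theorem exists_taylor_remainder_le_rpow {E : Type*} [NormedAddCommGroup E] [NormedSpace ℝ E]
    [ProperSpace E] {f : E → ℝ} (hf : ContDiff ℝ 1 f) {p q C : ℝ} (hp : 1 ≤ p) (hq : 0 ≤ q)
    (hqp : q ≤ p) (hC : 0 ≤ C) (hgrowth : ∀ x, |f x| ≤ C * (‖x‖ ^ q + 1)) (x₀ : E) :
    ∃ K, 0 ≤ K ∧ ∀ x ∈ Metric.ball x₀ 1, ∀ y, 1 ≤ ‖y‖ →
      ‖f (x + y) - f x - fderiv ℝ f x y‖ ≤ K * ‖y‖ ^ p := by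
  obtain ⟨L, hL⟩ := (isCompact_closedBall x₀ 1).exists_bound_of_continuousOn
    (hf.continuous_fderiv (by norm_num)).continuousOn
  have hL0 : 0 ≤ L := (norm_nonneg _).trans (hL x₀ (by simp))
  set R := ‖x₀‖ + 2 with hR
  have hR0 : 0 ≤ R := by positivity
  refine ⟨2 * (C * (R ^ q + 1)) + L, by positivity, fun x hx y hy => ?_⟩
  have hfx := hL x (Metric.ball_subset_closedBall hx)
  rw [mem_ball_iff_norm] at hx
  have hxn : ‖x‖ ≤ ‖x₀‖ + 1 := by
    have := norm_le_norm_add_norm_sub' x x₀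
    linarith
  have hyq : ‖y‖ ^ q ≤ ‖y‖ ^ p := Real.rpow_le_rpow_of_exponent_le hy hqp
  have hy1 : ‖y‖ ≤ ‖y‖ ^ p := Real.self_le_rpow_of_one_le hy hp
  have key : ∀ z, ‖z‖ ≤ R * ‖y‖ → |f z| ≤ C * (R ^ q + 1) * ‖y‖ ^ p := fun z hz => by
    refine (hgrowth z).trans ?_
    rw [mul_assoc]
    gcongr
    have h1 : ‖z‖ ^ q ≤ R ^ q * ‖y‖ ^ p := by
      refine (Real.rpow_le_rpow (norm_nonneg z) hz hq).trans ?_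
      rw [Real.mul_rpow hR0 (norm_nonneg y)]
      gcongr
    linarith
  have h1 : |f (x + y)| ≤ C * (R ^ q + 1) * ‖y‖ ^ p := by
    refine key _ ((norm_add_le x y).trans ?_)
    nlinarith [norm_nonneg x₀]
  have h2 : |f x| ≤ C * (R ^ q + 1) * ‖y‖ ^ p := by
    refine key _ ?_
    nlinarith [norm_nonneg x₀]
  have h3 : ‖fderiv ℝ f x y‖ ≤ L * ‖y‖ ^ p :=
    ((fderiv ℝ f x).le_of_opNorm_le hfx y).trans (by gcongr)
  have h4 := norm_sub_le (f (x + y) - f x) (fderiv ℝ f x y)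
  have h5 := norm_sub_le (f (x + y)) (f x)
  rw [Real.norm_eq_abs (f (x + y)), Real.norm_eq_abs (f x)] at h5
  linarith

theorem stmt4 (n : ℕ) (hn : 1 ≤ n) (p q : ℝ) (hp : 2 ≤ p) (hq1 : 1 ≤ q) (hqp : q ≤ p)
    (f : EuclideanSpace ℝ (Fin n) → ℝ) (hf : ContDiff ℝ 2 f)
    (C : ℝ) (hC : 0 < C) (hgrowth : ∀ x, |f x| ≤ C * (‖x‖ ^ q + 1))
    (ν : Measure (EuclideanSpace ℝ (Fin n)))
    (hmom : Integrable (fun y => max (‖y‖ ^ (2 : ℝ)) (‖y‖ ^ p)) ν) :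
    Continuous fun x : EuclideanSpace ℝ (Fin n) =>
      ∫ y, (f (x + y) - f x - fderiv ℝ f x y) ∂ν := by
  refine continuous_iff_continuousAt.2 fun x₀ => ?_
  obtain ⟨M, hM0, hM⟩ := exists_taylor_remainder_le hf x₀
  obtain ⟨K, hK0, hK⟩ := exists_taylor_remainder_le_rpow (hf.of_le (by norm_num))
    (by linarith) (by linarith) hqp hC.le hgrowth x₀
  have hfc := hf.continuous
  have hfd : Continuous (fderiv ℝ f) := hf.continuous_fderiv (by norm_num)
  refine continuousAt_of_dominated
    (bound := fun y => (M + K) * max (‖y‖ ^ (2 : ℝ)) (‖y‖ ^ p))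
    (.of_forall fun x => ?_) ?_ (hmom.const_mul _) (.of_forall fun y => ?_)
  · exact Continuous.aestronglyMeasurable (by fun_prop)
  · filter_upwards [Metric.ball_mem_nhds x₀ one_pos] with x hx
    refine .of_forall fun y => ?_
    rcases le_total ‖y‖ 1 with hy | hy
    · refine (hM x hx y hy).trans ?_
      rw [← Real.rpow_two]
      gcongr
      · linarith
      · exact le_max_left _ _
    · refine (hK x hx y hy).trans ?_
      gcongr
      · linarith
      · exact le_max_right _ _
  · exact Continuous.continuousAt (by fun_prop)
end

section
/- Let n ≥ 1, q > 0, u ∈ ℝⁿ and δ̂ ∈ ℝ. Let Λ and Θ be real symmetric positive definite n×n matrices, and let B be a real symmetric positive definite n×n matrix solving the algebraic Riccati equation BΘ⁻¹B + qB − Λ = 0. Set P := BΛ⁻¹B, c := 2Pu, d := (1/q)(2uᵀPu + δ̂ − uᵀPΘ⁻¹Pu), and φ(x) := xᵀBx + cᵀx + d. Then for every x, μ ∈ ℝⁿ, every real n×n matrix Σ and every Borel measure ν on ℝⁿ with ∫ ‖y‖² ν(dy) < ∞ satisfying Tr(ΣᵀBΣ) + ∫ yᵀBy ν(dy) ≥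 δ̂, one has (u+μ)ᵀ(2Bx + c) + Tr(ΣᵀBΣ) + ∫ yᵀBy ν(dy) − qφ(x) + xᵀΛx + μᵀΘμ ≥ 0. -/
open Matrix MeasureTheory

theorem dotProduct_mulVec_comm_of_isSymm {n : ℕ} {A : Matrix (Fin n) (Fin n) ℝ} (hA : Aᵀ = A)
    (x y : Fin n → ℝ) : x ⬝ᵥ A *ᵥ y = y ⬝ᵥ A *ᵥ x := by
  rw [dotProduct_mulVec, ← mulVec_transpose, hA, dotProduct_comm]

theorem posDef_transpose_eq {n : ℕ} {A : Matrix (Fin n) (Fin n) ℝ} (hA : A.PosDef) : Aᵀ = A := by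
  simpa [conjTranspose_eq_transpose_of_trivial] using hA.isHermitian.eq

/-- Completing the square: the minimum over `μ` of `μᵀΘμ + 2μᵀw` is `-wᵀΘ⁻¹w`. -/
theorem posDef_complete_square_nonneg {n : ℕ} {Θ : Matrix (Fin n) (Fin n) ℝ} (hΘ : Θ.PosDef)
    (μ w : Fin n → ℝ) : 0 ≤ μ ⬝ᵥ Θ *ᵥ μ + 2 * (μ ⬝ᵥ w) + w ⬝ᵥ Θ⁻¹ *ᵥ w := by
  have h : 0 ≤ (μ + Θ⁻¹ *ᵥ w) ⬝ᵥ Θ *ᵥ (μ + Θ⁻¹ *ᵥ w) := by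
    simpa using hΘ.posSemidef.dotProduct_mulVec_nonneg (μ + Θ⁻¹ *ᵥ w)
  have hdet : IsUnit Θ.det := (isUnit_iff_isUnit_det Θ).mp hΘ.isUnit
  have hcancel : Θ *ᵥ (Θ⁻¹ *ᵥ w) = w := by
    rw [mulVec_mulVec, mul_nonsing_inv Θ hdet, one_mulVec]
  have hcross := dotProduct_mulVec_comm_of_isSymm (posDef_transpose_eq hΘ) (Θ⁻¹ *ᵥ w) μ
  rw [hcancel] at hcross
  rw [mulVec_add, hcancel, dotProduct_add, add_dotProduct, add_dotProduct, hcross,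
    dotProduct_comm (Θ⁻¹ *ᵥ w) w] at h
  linarith

theorem stmt7 (n : ℕ) (hn : 1 ≤ n) (q : ℝ) (hq : 0 < q)
    (u : Fin n → ℝ) (δhat : ℝ)
    (Λ Θ B : Matrix (Fin n) (Fin n) ℝ)
    (hΛ : Λ.PosDef) (hΘ : Θ.PosDef) (hB : B.PosDef)
    (hRiccati : B * Θ⁻¹ * B + q • B - Λ = 0)
    (x μ : Fin n → ℝ) (S : Matrix (Fin n) (Fin n) ℝ)
    (ν : Measure (Fin n → ℝ))
    (hmom : Integrable (fun y : Fin n → ℝ => y ⬝ᵥ y) ν)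
    (hvar : δhat ≤ (Sᵀ * B * S).trace + ∫ y, y ⬝ᵥ B.mulVec y ∂ν) :
    let P := B * Λ⁻¹ * B
    let c := (2 : ℝ) • P.mulVec u
    let d := (1 / q) * (2 * (u ⬝ᵥ P.mulVec u) + δhat - u ⬝ᵥ (P * Θ⁻¹ * P).mulVec u)
    let φ := fun z : Fin n → ℝ => z ⬝ᵥ B.mulVec z + c ⬝ᵥ z + d
    0 ≤ (u + μ) ⬝ᵥ ((2 : ℝ) • B.mulVec x + c) + (Sᵀ * B * S).trace +
          (∫ y, y ⬝ᵥ B.mulVec y ∂ν) - q * φ x + x ⬝ᵥ Λ.mulVec x +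
          μ ⬝ᵥ Θ.mulVec μ := by
  intro P c d φ
  have hBt := posDef_transpose_eq hB
  have hTt : (Θ⁻¹)ᵀ = Θ⁻¹ := posDef_transpose_eq hΘ.inv
  have hLt : (Λ⁻¹)ᵀ = Λ⁻¹ := posDef_transpose_eq hΛ.inv
  have hPt : Pᵀ = P := by simp only [P, transpose_mul, hBt, hLt, Matrix.mul_assoc]
  have hdet : IsUnit Λ.det := (isUnit_iff_isUnit_det Λ).mp hΛ.isUnit
  have hΛ_eq : B * Θ⁻¹ * B + q • B = Λ := sub_eq_zero.mp hRiccati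
  have hP_eq : P * Θ⁻¹ * B + q • P = B := by
    calc P * Θ⁻¹ * B + q • P = B * Λ⁻¹ * (B * Θ⁻¹ * B + q • B) := by
          simp only [P, Matrix.mul_add, Matrix.mul_smul, Matrix.mul_assoc]
      _ = B := by rw [hΛ_eq, Matrix.mul_assoc, nonsing_inv_mul Λ hdet, Matrix.mul_one]
  have hsq := posDef_complete_square_nonneg hΘ μ (B *ᵥ x + P *ᵥ u)
  have hquad : (B *ᵥ x + P *ᵥ u) ⬝ᵥ Θ⁻¹ *ᵥ (B *ᵥ x + P *ᵥ u) =
      x ⬝ᵥ (B * Θ⁻¹ * B) *ᵥ x + 2 * (u ⬝ᵥ (P * Θ⁻¹ * B) *ᵥ x) +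
        u ⬝ᵥ (P * Θ⁻¹ * P) *ᵥ u := by
    have hmove : ∀ {A C : Matrix (Fin n) (Fin n) ℝ}, Aᵀ = A → ∀ y z : Fin n → ℝ,
        (A *ᵥ y) ⬝ᵥ Θ⁻¹ *ᵥ (C *ᵥ z) = y ⬝ᵥ (A * Θ⁻¹ * C) *ᵥ z := by
      intro A C hA y z
      rw [dotProduct_comm, dotProduct_mulVec_comm_of_isSymm hA, mulVec_mulVec, mulVec_mulVec,
        Matrix.mul_assoc]
    have hcross := dotProduct_mulVec_comm_of_isSymm hTt (B *ᵥ x) (P *ᵥ u)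
    rw [mulVec_add, dotProduct_add, add_dotProduct, add_dotProduct, hcross,
      hmove hBt, hmove hPt, hmove hPt]
    ring
  have hxΛ : x ⬝ᵥ Λ *ᵥ x = x ⬝ᵥ (B * Θ⁻¹ * B) *ᵥ x + q * (x ⬝ᵥ B *ᵥ x) := by
    simpa only [add_mulVec, smul_mulVec, dotProduct_add, dotProduct_smul, smul_eq_mul] using
      congrArg (fun M => x ⬝ᵥ M *ᵥ x) hΛ_eq.symm
  have huB : u ⬝ᵥ B *ᵥ x = u ⬝ᵥ (P * Θ⁻¹ * B) *ᵥ x + q * (u ⬝ᵥ P *ᵥ x) := by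
    simpa only [add_mulVec, smul_mulVec, dotProduct_add, dotProduct_smul, smul_eq_mul] using
      congrArg (fun M => u ⬝ᵥ M *ᵥ x) hP_eq.symm
  have hqd : q * d = 2 * (u ⬝ᵥ P *ᵥ u) + δhat - u ⬝ᵥ (P * Θ⁻¹ * P) *ᵥ u := by
    simp only [d]
    field_simp
  have hc : c ⬝ᵥ x = 2 * (u ⬝ᵥ P *ᵥ x) := by
    simp only [c]
    rw [smul_dotProduct, smul_eq_mul, dotProduct_comm, dotProduct_mulVec_comm_of_isSymm hPt]
  have hqφ : q * φ x = q * (x ⬝ᵥ B *ᵥ x) + 2 * (q * (u ⬝ᵥ P *ᵥ x)) + q * d := by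
    simp only [φ, hc]
    ring
  have hdrift : (u + μ) ⬝ᵥ ((2 : ℝ) • B *ᵥ x + c) =
      2 * (u ⬝ᵥ B *ᵥ x) + 2 * (u ⬝ᵥ P *ᵥ u) + 2 * (μ ⬝ᵥ (B *ᵥ x + P *ᵥ u)) := by
    simp only [c, add_dotProduct, dotProduct_add, dotProduct_smul, smul_eq_mul]
    ring
  rw [hquad] at hsq
  rw [hdrift, hqφ, hqd, hxΛ]
  linarith
end

section
/- Let n ≥ 1, q > 0, u ∈ ℝⁿ and δ̂ ∈ ℝ. Let Λ and Θ be real symmetric positive definite n×n matrices, and let B be a real symmetric positive definite n×n matrix solving the algebraic Riccati equation BΘ⁻¹B + qB − Λ = 0. Set P := BΛ⁻¹B, c := 2Pu, d := (1/q)(2uᵀPu + δ̂ − uᵀPΘ⁻¹Pu), φ(x) := xᵀBx + cᵀx + d, and μ̂(x) := −Θ⁻¹(Bx + Pu). Then for every x ∈ ℝⁿ, (u + μ̂(x))ᵀ(2Bx + c) + δ̂ − qφ(x) + xᵀΛx + μ̂(x)ᵀΘμ̂(x) = 0. -/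
open Matrix

theorem Matrix.IsSymm.dotProduct_mulVec_comm {n R : Type*} [Fintype n] [CommSemiring R]
    {A : Matrix n n R} (hA : A.IsSymm) (v w : n → R) :
    v ⬝ᵥ A.mulVec w = A.mulVec v ⬝ᵥ w := by
  rw [dotProduct_mulVec, ← mulVec_transpose, hA.eq]

theorem stmt8 (n : ℕ) (hn : 1 ≤ n) (q : ℝ) (hq : 0 < q)
    (u : Fin n → ℝ) (δhat : ℝ)
    (Λ Θ B : Matrix (Fin n) (Fin n) ℝ)
    (hΛ : Λ.PosDef) (hΘ : Θ.PosDef) (hB : B.PosDef)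
    (hRiccati : B * Θ⁻¹ * B + q • B - Λ = 0) :
    let P := B * Λ⁻¹ * B
    let c := (2 : ℝ) • P.mulVec u
    let d := (1 / q) * (2 * (u ⬝ᵥ P.mulVec u) + δhat - u ⬝ᵥ (P * Θ⁻¹ * P).mulVec u)
    let φ := fun z : Fin n → ℝ => z ⬝ᵥ B.mulVec z + c ⬝ᵥ z + d
    let μhat := fun z : Fin n → ℝ => -(Θ⁻¹.mulVec (B.mulVec z + P.mulVec u))
    ∀ x : Fin n → ℝ,
      (u + μhat x) ⬝ᵥ ((2 : ℝ) • B.mulVec x + c) + δhat - q * φ x +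
        x ⬝ᵥ Λ.mulVec x + μhat x ⬝ᵥ Θ.mulVec (μhat x) = 0 := by
  intro P c d φ μhat x
  have hBs : B.IsSymm := hB.isHermitian
  have hΘs : Θ⁻¹.IsSymm := hΘ.inv.isHermitian
  have hΛs : Λ⁻¹.IsSymm := hΛ.inv.isHermitian
  have hPs : P.IsSymm := by
    simp only [P, IsSymm, transpose_mul, hBs.eq, hΛs.eq, Matrix.mul_assoc]
  have hΛeq : Λ = B * Θ⁻¹ * B + q • B := (sub_eq_zero.mp hRiccati).symm
  have hBP : B * Θ⁻¹ * P + q • P = B := by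
    calc B * Θ⁻¹ * P + q • P = (B * Θ⁻¹ * B + q • B) * Λ⁻¹ * B := by
          simp only [P, Matrix.add_mul, Matrix.smul_mul, Matrix.mul_assoc]
      _ = B := by
          rw [← hΛeq, Matrix.mul_nonsing_inv _ ((isUnit_iff_isUnit_det _).mp hΛ.isUnit),
            Matrix.one_mul]
  have hquad : x ⬝ᵥ Λ.mulVec x
      = B.mulVec x ⬝ᵥ Θ⁻¹.mulVec (B.mulVec x) + q * (x ⬝ᵥ B.mulVec x) := by
    rw [hΛeq, add_mulVec, smul_mulVec, dotProduct_add, dotProduct_smul, smul_eq_mul,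
      ← mulVec_mulVec, ← mulVec_mulVec, hBs.dotProduct_mulVec_comm x (Θ⁻¹.mulVec _)]
  have hlin : u ⬝ᵥ B.mulVec x
      = B.mulVec x ⬝ᵥ Θ⁻¹.mulVec (P.mulVec u) + q * (P.mulVec u ⬝ᵥ x) := by
    have h : B.mulVec u = B.mulVec (Θ⁻¹.mulVec (P.mulVec u)) + q • P.mulVec u := by
      conv_lhs => rw [← hBP]
      rw [add_mulVec, smul_mulVec, ← mulVec_mulVec, ← mulVec_mulVec]
    rw [hBs.dotProduct_mulVec_comm, h, add_dotProduct, smul_dotProduct, smul_eq_mul,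
      ← hBs.dotProduct_mulVec_comm, dotProduct_comm (B.mulVec x)]
  have hconst : u ⬝ᵥ (P * Θ⁻¹ * P).mulVec u = P.mulVec u ⬝ᵥ Θ⁻¹.mulVec (P.mulVec u) := by
    rw [← mulVec_mulVec, ← mulVec_mulVec, hPs.dotProduct_mulVec_comm]
  have hd : q * d = 2 * (u ⬝ᵥ P.mulVec u) + δhat
      - P.mulVec u ⬝ᵥ Θ⁻¹.mulVec (P.mulVec u) := by
    simp only [d, hconst]
    field_simp
  have hΘμ : Θ.mulVec (μhat x) = -(B.mulVec x + P.mulVec u) := by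
    simp only [μhat]
    rw [mulVec_neg, mulVec_mulVec,
      Matrix.mul_nonsing_inv _ ((isUnit_iff_isUnit_det _).mp hΘ.isUnit), one_mulVec]
  have hcross : P.mulVec u ⬝ᵥ Θ⁻¹.mulVec (B.mulVec x)
      = B.mulVec x ⬝ᵥ Θ⁻¹.mulVec (P.mulVec u) := by
    rw [hΘs.dotProduct_mulVec_comm, dotProduct_comm]
  rw [hΘμ, hquad]
  simp only [φ, mul_add, hd]
  simp only [μhat, c, mulVec_add, add_dotProduct, dotProduct_add, neg_dotProduct, dotProduct_neg,
    smul_dotProduct, dotProduct_smul, smul_eq_mul, neg_add]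
  rw [dotProduct_comm (Θ⁻¹.mulVec (B.mulVec x)) (B.mulVec x),
    dotProduct_comm (Θ⁻¹.mulVec (B.mulVec x)) (P.mulVec u),
    dotProduct_comm (Θ⁻¹.mulVec (P.mulVec u)) (B.mulVec x),
    dotProduct_comm (Θ⁻¹.mulVec (P.mulVec u)) (P.mulVec u), hcross, hlin]
  ring
end

section
/- Let q > 0, κ > 0 and b̂ > 0. Let f, φ : ℝ → ℝ with φ twice differentiable, φ even (φ(−x) = φ(x)), φ nondecreasing on [0,∞), and φ(b̂) − φ(0) = κ. Assume (1/2)φ''(x) − qφ(x) + f(x) = 0 for all x with |x| < b̂, and (1/2)φ''(x) − (q+1)φ(x) + f(x) + κ + φ(0) = 0 for all x with |x| > b̂. Then for every x ∈ ℝ with |x| ≠ b̂: (i) for every a ∈ [0,1], (1/2)φ''(x) − qφ(x) + f(x) + a(κ + φ(0) − φ(x)) ≥ 0; and (ii) there exists a ∈ [0,1] (namely a = 0 if |x| < b̂ and a = 1 if |x| > b̂) for which this expression equals 0. Hence inf_{a ∈ [0,1]} { (1/2)φ''(x) − qφ(x) + f(x) + a(κ + φ(0) − φ(x)) } = 0 for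 all x with |x| ≠ b̂. -/
theorem stmt12 (q κ bhat : ℝ) (hq : 0 < q) (hκ : 0 < κ) (hbhat : 0 < bhat)
    (f φ : ℝ → ℝ)
    (hφ : Differentiable ℝ φ) (hφ' : Differentiable ℝ (deriv φ))
    (heven : ∀ x : ℝ, φ (-x) = φ x)
    (hmono : MonotoneOn φ (Set.Ici (0 : ℝ)))
    (hgap : φ bhat - φ 0 = κ)
    (hin : ∀ x : ℝ, |x| < bhat →
      (1 / 2) * deriv (deriv φ) x - q * φ x + f x = 0)
    (hout : ∀ x : ℝ, bhat < |x| →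
      (1 / 2) * deriv (deriv φ) x - (q + 1) * φ x + f x + κ + φ 0 = 0) :
    ∀ x : ℝ, |x| ≠ bhat →
      (∀ a ∈ Set.Icc (0 : ℝ) 1,
        0 ≤ (1 / 2) * deriv (deriv φ) x - q * φ x + f x + a * (κ + φ 0 - φ x)) ∧
      (∃ a ∈ Set.Icc (0 : ℝ) 1,
        (1 / 2) * deriv (deriv φ) x - q * φ x + f x + a * (κ + φ 0 - φ x) = 0) ∧
      sInf ((fun a : ℝ =>
          (1 / 2) * deriv (deriv φ) x - q * φ x + f x + a * (κ + φ 0 - φ x)) ''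
        Set.Icc (0 : ℝ) 1) = 0 := by
  intro x hx
  have habs : φ |x| = φ x := by
    rcases abs_choice x with h | h <;> simp [h, heven]
  have hnonneg : ∀ a ∈ Set.Icc (0 : ℝ) 1,
      0 ≤ (1 / 2) * deriv (deriv φ) x - q * φ x + f x + a * (κ + φ 0 - φ x) := by
    rintro a ⟨ha0, ha1⟩
    rcases lt_or_gt_of_ne hx with h | h
    · have hle := hmono (abs_nonneg x) hbhat.le h.le
      have := mul_nonneg ha0 (show 0 ≤ κ + φ 0 - φ x by linarith)
      linarith [hin x h]
    · have hle := hmono hbhat.le (abs_nonneg x) h.le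
      have := mul_nonneg (sub_nonneg.2 ha1) (show 0 ≤ φ x - κ - φ 0 by linarith)
      linarith [hout x h]
  have hzero : ∃ a ∈ Set.Icc (0 : ℝ) 1,
      (1 / 2) * deriv (deriv φ) x - q * φ x + f x + a * (κ + φ 0 - φ x) = 0 := by
    rcases lt_or_gt_of_ne hx with h | h
    · exact ⟨0, by simp, by linarith [hin x h]⟩
    · exact ⟨1, by simp, by linarith [hout x h]⟩
  refine ⟨hnonneg, hzero, IsLeast.csInf_eq ⟨hzero, ?_⟩⟩
  rintro _ ⟨a, ha, rfl⟩
  exact hnonneg a ha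
end
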